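/- Let λ ∈ Λ_{n,m}, let c be a bad point of λ, and let a > c satisfy λ(a) = ∧. Then a = c'^∧ for some good point c' of λ (every ∧-point to the right of a bad point is the partner of a good point). Consequently λ orients its own diagram, i.e. the circle diagram \underline{λ}λ\overline{λ} is oriented. -/

import Mathlib

open scoped Classical

namespace ArcAlgebra

variable {m : ℕ}

/-- `l : Fin m → Bool` is a weight of type `(n, m)`: positions are `0`-based (position
`a : Fin m` corresponds to the 1-based position `a.val + 1`), the value `true` stands for
`∨` and `false` for `∧`, and `l` takes the value `∨` exactly `n` times. -/
def IsWeight (n : ℕ) (l : Fin m → Bool) : Prop :=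
  (Finset.univ.filter (fun a => l a = true)).card = n

/-- The number of `∨`'s strictly between `c` and `c'` equals the number of `∧`'s strictly
between `c` and `c'`. -/
def Balanced (l : Fin m → Bool) (c c' : Fin m) : Prop :=
  (Finset.univ.filter (fun x => c < x ∧ x < c' ∧ l x = true)).card =
    (Finset.univ.filter (fun x => c < x ∧ x < c' ∧ l x = false)).card

/-- `Matches l c c'` says `c` is a good point of `l` with partner `c^∧ = c'`: one has
`l c = ∨`, `c < c'`, `l c' = ∧`, the counts of `∨`'s and `∧`'s strictly between `c` and
`c'` balance, and `c'` is minimal with these properties. -/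
def Matches (l : Fin m → Bool) (c c' : Fin m) : Prop :=
  l c = true ∧ c < c' ∧ l c' = false ∧ Balanced l c c' ∧
    ∀ d : Fin m, c < d → l d = false → Balanced l c d → c' ≤ d

/-- `c` is a good point of `l`. -/
def IsGood (l : Fin m → Bool) (c : Fin m) : Prop :=
  ∃ c', Matches l c c'

/-- `a` is a ray position of `l`: neither a good point of `l` nor the partner `c^∧` of a
good point `c` of `l`. -/
def RayPos (l : Fin m → Bool) (a : Fin m) : Prop :=
  ¬ IsGood l a ∧ ¬ ∃ c, Matches l c a

/-- `η` orients the diagram of `l`: `η(c) ≠ η(c^∧)` for every good point `c` of `l`, and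
whenever `a < b` are ray positions of `l` with `η a = ∨`, also `η b = ∨`. -/
def Orients (η l : Fin m → Bool) : Prop :=
  (∀ c c', Matches l c c' → η c ≠ η c') ∧
    ∀ a b, RayPos l a → RayPos l b → a < b → η a = true → η b = true

/-- The number of good points of `l`. -/
noncomputable def goodCount (l : Fin m → Bool) : ℕ :=
  (Finset.univ.filter (fun c => IsGood l c)).card

/-- The weight `w_l`: it takes the value `∨` exactly at the partners `c^∧` of the good
points `c` of `l` and at the `n − goodCount l` largest ray positions of `l` (a ray position
`a` is among the `k` largest ray positions iff fewer than `k` ray positions exceed it). -/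
noncomputable def wMax (n : ℕ) (l : Fin m → Bool) : Fin m → Bool := fun a =>
  if (∃ c, Matches l c a) ∨
      (RayPos l a ∧
        (Finset.univ.filter (fun b => RayPos l b ∧ a < b)).card < n - goodCount l)
  then true else false

/-- The Bruhat order on weights: `l ≤ μ` iff there is a bijection `f` from `l⁻¹(∨)` to
`μ⁻¹(∨)` with `x ≤ f x` for all `x`. -/
def BruhatLE (l μ : Fin m → Bool) : Prop :=
  ∃ f : {x : Fin m // l x = true} → {y : Fin m // μ y = true},
    Function.Bijective f ∧ ∀ x, x.1 ≤ (f x).1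

end ArcAlgebra

namespace ArcAlgebra

/-- The height of the lattice path of `l` after its first `k` steps, where a `∨` is an up-step
and a `∧` is a down-step. -/
def height {m : ℕ} (l : Fin m → Bool) (k : ℕ) : ℤ :=
  ∑ x : Fin m, if x.val < k then (if l x = true then 1 else -1) else 0

theorem height_succ {m : ℕ} (l : Fin m → Bool) (a : Fin m) :
    height l (a.val + 1) = height l a.val + if l a = true then 1 else -1 := by
  rw [← sub_eq_iff_eq_add']
  unfold height
  rw [← Finset.sum_sub_distrib, Finset.sum_eq_single a]
  · simp
  · intro x _ hx
    have : x.val ≠ a.val := fun h => hx (Fin.ext h)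
    have : x.val < a.val + 1 ↔ x.val < a.val := by omega
    simp [this]
  · simp

theorem balanced_iff_height_eq {m : ℕ} (l : Fin m → Bool) {c d : Fin m} (hcd : c < d) :
    Balanced l c d ↔ height l d.val = height l (c.val + 1) := by
  have key : height l d.val - height l (c.val + 1) =
      ((Finset.univ.filter (fun x => c < x ∧ x < d ∧ l x = true)).card : ℤ) -
        ((Finset.univ.filter (fun x => c < x ∧ x < d ∧ l x = false)).card : ℤ) := by
    unfold height
    rw [Finset.card_filter, Finset.card_filter]
    push_cast
    rw [← Finset.sum_sub_distrib, ← Finset.sum_sub_distrib]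
    refine Finset.sum_congr rfl fun x _ => ?_
    simp only [Fin.lt_def] at hcd ⊢
    cases l x <;> simp <;> split_ifs <;> omega
  unfold Balanced
  omega

theorem isGood_of_balanced {m : ℕ} {l : Fin m → Bool} {c d : Fin m} (hc : l c = true)
    (hcd : c < d) (hd : l d = false) (hb : Balanced l c d) : IsGood l c := by
  obtain ⟨e, ⟨hce, he, heb⟩, hmin⟩ := WellFounded.has_min (wellFounded_lt (α := Fin m))
    {e | c < e ∧ l e = false ∧ Balanced l c e} ⟨d, hcd, hd, hb⟩
  exact ⟨e, hc, hce, he, heb, fun x h₁ h₂ h₃ => not_lt.mp (hmin x ⟨h₁, h₂, h₃⟩)⟩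

theorem height_lt_of_bad {m : ℕ} {l : Fin m → Bool} {c : Fin m} (hc : l c = true)
    (hbad : ¬ IsGood l c) {k : ℕ} (hck : c.val + 1 ≤ k) (hk : k ≤ m) :
    height l c.val < height l k := by
  have hsc := height_succ l c
  rw [if_pos hc] at hsc
  induction k, hck using Nat.le_induction with
  | base => omega
  | succ k hck ih =>
    specialize ih (by omega)
    have hs : height l (k + 1) = height l k + _ := height_succ l ⟨k, hk⟩
    cases hd : l ⟨k, hk⟩ with
    | true => simp only [hd, if_true] at hs; omega
    | false =>
      simp only [hd, Bool.false_eq_true, if_false] at hs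
      have hlt : c < (⟨k, hk⟩ : Fin m) := Fin.lt_def.mpr hck
      have hne : height l k ≠ height l (c.val + 1) := fun h =>
        hbad (isGood_of_balanced hc hlt hd ((balanced_iff_height_eq l hlt).mpr h))
      omega

theorem exists_matches_of_bad_lt {m : ℕ} {l : Fin m → Bool} {c a : Fin m} (hc : l c = true)
    (hbad : ¬ IsGood l c) (hca : c < a) (ha : l a = false) : ∃ c', Matches l c' a := by
  have hsa := height_succ l a
  simp only [ha, Bool.false_eq_true, if_false] at hsa
  have hlt := height_lt_of_bad hc hbad (k := a.val + 1) (by omega) a.isLt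
  let P : ℕ → Prop := fun k => height l k ≤ height l (a.val + 1)
  have hP : P (Nat.findGreatest P a.val) :=
    Nat.findGreatest_spec (P := P) (m := c.val) (by omega) hlt.le
  have hmax : ∀ k, Nat.findGreatest P a.val < k → k ≤ a.val → ¬ P k :=
    fun k h₁ h₂ => Nat.findGreatest_is_greatest h₁ h₂
  have hle : Nat.findGreatest P a.val ≤ a.val := Nat.findGreatest_le _
  generalize Nat.findGreatest P a.val = p at hP hmax hle
  simp only [P, not_le] at hP hmax
  have hpa : p < a.val := by
    rcases hle.lt_or_eq with h | h
    · exact h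
    · subst h; omega
  have hsp : height l (p + 1) = height l p + _ := height_succ l ⟨p, by omega⟩
  have hup := hmax (p + 1) (by omega) hpa
  have hlp : l ⟨p, by omega⟩ = true := by
    by_contra h
    rw [if_neg h] at hsp
    omega
  rw [if_pos hlp] at hsp
  have hpa' : (⟨p, by omega⟩ : Fin m) < a := Fin.lt_def.mpr hpa
  refine ⟨⟨p, by omega⟩, hlp, hpa', ha, (balanced_iff_height_eq l hpa').mpr ?_, ?_⟩
  · change _ = height l (p + 1)
    omega
  · intro d hpd hd hb
    by_contra! hda
    have hb' : height l d.val = height l (p + 1) := (balanced_iff_height_eq l hpd).mp hb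
    have hsd := height_succ l d
    simp only [hd, Bool.false_eq_true, if_false] at hsd
    have := hmax (d.val + 1) (Nat.lt_succ_of_lt hpd) hda
    omega

theorem orients_self {m : ℕ} (l : Fin m → Bool) : Orients l l := by
  refine ⟨fun c c' ⟨hc, _, hc', _⟩ => by simp [hc, hc'], fun a b ha hb hab hla => ?_⟩
  by_contra hlb
  exact hb.2 (exists_matches_of_bad_lt hla ha.1 hab (Bool.eq_false_iff.mpr hlb))

end ArcAlgebra

open ArcAlgebra

/-- Let `λ ∈ Λ_{n,m}`, let `c` be a bad point of `λ`, and let `a > c`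
satisfy `λ(a) = ∧`.  Then `a = c'^∧` for some good point `c'` of `λ`.  Consequently `λ`
orients its own diagram, i.e. the circle diagram `\underline{λ}λ\overline{λ}` is
oriented. -/
theorem statement9 (n m : ℕ) (l : Fin m → Bool) (hl : IsWeight n l)
    (c : Fin m) (hc : l c = true) (hbad : ¬ IsGood l c)
    (a : Fin m) (hca : c < a) (hla : l a = false) :
    (∃ c', Matches l c' a) ∧ Orients l l :=
  ⟨exists_matches_of_bad_lt hc hbad hca hla, orients_self l⟩
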